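/- For every nonempty subset S of {1,…,n}, the moment m(S) equals the sum over all set partitions {B_1,…,B_k} of S of the product ∏_{j=1}^k c(B_j) of the cumulants of the blocks. -/

import Mathlib

/-- The joint cumulant `c(S)` associated to a system of joint moments
`m : Finset (Fin n) → ℂ`:
`c(S) = Σ_{partitions {B₁,…,B_k} of S} (k−1)! (−1)^(k−1) ∏_j m(B_j)`. -/
noncomputable def cumulant {n : ℕ} (m : Finset (Fin n) → ℂ) (S : Finset (Fin n)) : ℂ :=
  ∑ P : Finpartition S,
    (Nat.factorial (P.parts.card - 1) : ℂ) * (-1) ^ (P.parts.card - 1) *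
      ∏ B ∈ P.parts, m B

open Finset in
/-- Choosing a block of a partition of `S` amounts to choosing a nonempty subset of `S` together
with a partition of its complement. -/
theorem Finpartition.sum_sum_parts_erase {α M : Type*} [DecidableEq α] [AddCommMonoid M]
    (S : Finset α) (F : Finset α → Finset (Finset α) → M) :
    ∑ P : Finpartition S, ∑ B ∈ P.parts, F B (P.parts.erase B) =
      ∑ B ∈ S.powerset.erase ∅, ∑ Q : Finpartition (S \ B), F B Q.parts := by
  have parts_avoid : ∀ (P : Finpartition S) {B : Finset α}, B ∈ P.parts →
      (P.avoid B).parts = P.parts.erase B := by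
    intro P B hB
    have hd : ∀ D ∈ P.parts, D ≠ B → D \ B = D := fun D hD hne =>
      sdiff_eq_self_of_disjoint (P.disjoint hD hB hne)
    ext C
    rw [P.mem_avoid, mem_erase]
    constructor
    · rintro ⟨D, hD, hDB, rfl⟩
      have hne : D ≠ B := fun h => hDB h.le
      rw [hd D hD hne]
      exact ⟨hne, hD⟩
    · rintro ⟨hne, hC⟩
      refine ⟨C, hC, fun hle => P.ne_empty hC ?_, hd C hC hne⟩
      rw [← hd C hC hne]
      exact sdiff_eq_empty_iff_subset.2 hle
  have notMem : ∀ {B : Finset α} (Q : Finpartition (S \ B)), B ≠ ∅ → B ∉ Q.parts := by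
    intro B Q hB h
    obtain ⟨x, hx⟩ := nonempty_iff_ne_empty.2 hB
    exact (mem_sdiff.1 (Q.subset h hx)).2 hx
  rw [sum_sigma', sum_sigma']
  refine sum_bij' (fun x _ => ⟨x.2, x.1.avoid x.2⟩)
    (fun y hy => ⟨y.2.extend (b := y.1) (c := S) ?_ sdiff_disjoint ?_, y.1⟩) ?_ ?_ ?_ ?_ ?_
  · exact (mem_erase.1 (mem_sigma.1 hy).1).1
  · exact sdiff_union_of_subset (mem_powerset.1 (mem_erase.1 (mem_sigma.1 hy).1).2)
  · rintro ⟨P, B⟩ h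
    have hB : B ∈ P.parts := (mem_sigma.1 h).2
    simp [P.ne_empty hB, P.subset hB]
  · rintro ⟨B, Q⟩ h
    simp
  · rintro ⟨P, B⟩ h
    have hB : B ∈ P.parts := (mem_sigma.1 h).2
    refine Sigma.ext (Finpartition.ext ?_) HEq.rfl
    simp [parts_avoid P hB, insert_erase hB]
  · rintro ⟨B, Q⟩ h
    have hB : B ≠ ∅ := (mem_erase.1 (mem_sigma.1 h).1).1
    refine Sigma.ext rfl (heq_of_eq (Finpartition.ext ?_))
    rw [parts_avoid _ (by simp)]
    simp [erase_insert (notMem Q hB)]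
  · rintro ⟨P, B⟩ h
    have hB : B ∈ P.parts := (mem_sigma.1 h).2
    simp [parts_avoid P hB]

/-- The sum over the partitions of `S` of the product of the values of `f` on the blocks, weighted
by a function `w` of the number of blocks. -/
def partitionSum {α R : Type*} [DecidableEq α] [CommRing R] (w : ℕ → R) (f : Finset α → R)
    (S : Finset α) : R :=
  ∑ P : Finpartition S, w P.parts.card * ∏ B ∈ P.parts, f B

section partitionSum

open Finset

variable {α R : Type*} [DecidableEq α] [CommRing R]

theorem partitionSum_empty (w : ℕ → R) (f : Finset α → R) : partitionSum w f ∅ = w 0 := by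
  have h : ∀ P : Finpartition (∅ : Finset α), P.parts = ∅ := fun P =>
    P.parts_eq_empty_iff.2 rfl
  have hc : Fintype.card (Finpartition (∅ : Finset α)) = 1 :=
    Fintype.card_eq_one_iff.2 ⟨⊥, fun P => Finpartition.ext ((h P).trans (h ⊥).symm)⟩
  simp [partitionSum, h, hc]

/-- Splitting off the block that contains a given element. -/
theorem partitionSum_eq_sum_mem (w : ℕ → R) (f : Finset α → R) {S : Finset α} {a : α}
    (ha : a ∈ S) :
    partitionSum w f S =
      ∑ B ∈ S.powerset with a ∈ B, f B * partitionSum (fun k => w (k + 1)) f (S \ B) := by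
  have key := Finpartition.sum_sum_parts_erase S
    fun B p => if a ∈ B then f B * (w (p.card + 1) * ∏ C ∈ p, f C) else 0
  have hfilter : {B ∈ S.powerset.erase ∅ | a ∈ B} = {B ∈ S.powerset | a ∈ B} := by
    ext B
    simp only [mem_filter, mem_erase]
    exact ⟨fun h => ⟨h.1.2, h.2⟩, fun h => ⟨⟨ne_empty_of_mem h.2, h.1⟩, h.2⟩⟩
  calc partitionSum w f S
    _ = ∑ P : Finpartition S, ∑ B ∈ P.parts, if a ∈ B then
          f B * (w ((P.parts.erase B).card + 1) * ∏ C ∈ P.parts.erase B, f C) else 0 := by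
      refine sum_congr rfl fun P _ => ?_
      have hp := P.part_mem.2 ha
      rw [sum_eq_single_of_mem _ hp fun B hB hne =>
        if_neg fun h => hne (P.part_eq_of_mem hB h).symm, if_pos (P.mem_part_self.2 ha),
        card_erase_add_one hp, ← mul_prod_erase _ _ hp]
      ring
    _ = _ := by
      rw [key, ← hfilter, sum_filter]
      refine sum_congr rfl fun B _ => ?_
      split_ifs
      · rw [partitionSum, mul_sum]
      · simp

/-- Splitting off an arbitrary block. -/
theorem partitionSum_card_mul (w : ℕ → R) (f : Finset α → R) (S : Finset α) :
    partitionSum (fun k => k * w (k - 1)) f S =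
      ∑ B ∈ S.powerset.erase ∅, f B * partitionSum w f (S \ B) := by
  have key := Finpartition.sum_sum_parts_erase S
    fun B p => f B * (w p.card * ∏ C ∈ p, f C)
  simp only [partitionSum, mul_sum]
  rw [← key]
  refine sum_congr rfl fun P _ => ?_
  rw [mul_assoc, ← nsmul_eq_mul, ← sum_const]
  refine sum_congr rfl fun B hB => ?_
  rw [card_erase_of_mem hB, ← mul_prod_erase _ _ hB]
  ring

/-- The weights `(-1) ^ k * k!` invert `f`, extended by `1` at the empty set, for the subset
convolution. -/
theorem sum_mul_partitionSum_eq_zero (f : Finset α → R) {S : Finset α} (hS : S ≠ ∅) :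
    ∑ B ∈ S.powerset, (if B = ∅ then 1 else f B) *
      partitionSum (fun k => (-1) ^ k * (k.factorial : R)) f (S \ B) = 0 := by
  rw [← add_sum_erase _ _ (empty_mem_powerset S)]
  have h : ∑ B ∈ S.powerset.erase ∅, (if B = ∅ then 1 else f B) *
      partitionSum (fun k => (-1) ^ k * (k.factorial : R)) f (S \ B) =
      -partitionSum (fun k => (-1) ^ k * (k.factorial : R)) f S := by
    rw [sum_congr rfl fun B hB => by rw [if_neg (mem_erase.1 hB).1], ← partitionSum_card_mul]
    simp only [partitionSum]
    rw [← sum_neg_distrib]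
    refine sum_congr rfl fun P _ => ?_
    obtain ⟨k, hk⟩ := Nat.exists_eq_add_one.2 (card_pos.2 (P.parts_nonempty hS))
    rw [hk, Nat.add_sub_cancel, Nat.factorial_succ, pow_succ]
    push_cast
    ring
  rw [h]
  simp

/-- The recursion expressing moments through the cumulants of the sets that contain a given
element. -/
theorem sum_partitionSum_mul_sdiff (f : Finset α → R) {S : Finset α} {a : α} (ha : a ∈ S) :
    ∑ B ∈ S.powerset with a ∈ B,
      partitionSum (fun k => (-1) ^ (k - 1) * ((k - 1).factorial : R)) f B *
        (if S \ B = ∅ then 1 else f (S \ B)) = f S := by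
  set h := partitionSum (fun k => (-1) ^ k * (k.factorial : R)) f with h_def
  calc
    _ = ∑ B ∈ S.powerset with a ∈ B, ∑ A ∈ B.powerset with a ∈ A,
        f A * ((if S \ B = ∅ then 1 else f (S \ B)) * h (B \ A)) := by
      refine sum_congr rfl fun B hB => ?_
      rw [partitionSum_eq_sum_mem _ _ (mem_filter.1 hB).2, sum_mul]
      refine sum_congr rfl fun A _ => ?_
      simp only [Nat.add_sub_cancel, ← h_def]
      ring
    _ = ∑ A ∈ S.powerset with a ∈ A, ∑ B ∈ S.powerset with A ⊆ B,
        f A * ((if S \ B = ∅ then 1 else f (S \ B)) * h (B \ A)) := by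
      refine sum_comm' fun B A => ?_
      simp only [mem_filter, mem_powerset]
      exact ⟨fun ⟨⟨h1, _⟩, h3, h4⟩ => ⟨⟨h1, h3⟩, h3.trans h1, h4⟩,
        fun ⟨⟨h1, h2⟩, _, h4⟩ => ⟨⟨h1, h2 h4⟩, h2, h4⟩⟩
    _ = ∑ A ∈ S.powerset with a ∈ A, f A * ∑ C ∈ (S \ A).powerset,
        (if C = ∅ then 1 else f C) * h ((S \ A) \ C) := by
      refine sum_congr rfl fun A hA => ?_
      have hAS : A ⊆ S := mem_powerset.1 (mem_filter.1 hA).1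
      rw [← mul_sum]
      congr 1
      refine sum_bij' (fun B _ => S \ B) (fun C _ => S \ C) ?_ ?_ ?_ ?_ ?_
      · intro B hB
        exact mem_powerset.2 (sdiff_subset_sdiff subset_rfl (mem_filter.1 hB).2)
      · intro C hC
        replace hC := mem_powerset.1 hC
        refine mem_filter.2 ⟨mem_powerset.2 sdiff_subset, fun x hx => ?_⟩
        exact mem_sdiff.2 ⟨hAS hx, fun hxC => (mem_sdiff.1 (hC hxC)).2 hx⟩
      · intro B hB
        exact Finset.sdiff_sdiff_eq_self (mem_powerset.1 (mem_filter.1 hB).1)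
      · intro C hC
        exact Finset.sdiff_sdiff_eq_self ((mem_powerset.1 hC).trans sdiff_subset)
      · intro B hB
        have hBS := mem_powerset.1 (mem_filter.1 hB).1
        rw [sdiff_right_comm, Finset.sdiff_sdiff_eq_self hBS]
    _ = f S := by
      rw [sum_eq_single_of_mem S (by simp [ha])]
      · simp [h_def, partitionSum_empty]
      · intro A hA hne
        have hAS : A ⊆ S := mem_powerset.1 (mem_filter.1 hA).1
        rw [sum_mul_partitionSum_eq_zero f fun h0 =>
          hne (hAS.antisymm (sdiff_eq_empty_iff_subset.1 h0)), mul_zero]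

end partitionSum

theorem cumulant_eq_partitionSum {n : ℕ} (m : Finset (Fin n) → ℂ) :
    cumulant m = partitionSum (fun k => (-1) ^ (k - 1) * ((k - 1).factorial : ℂ)) m := by
  ext S
  simp only [cumulant, partitionSum]
  exact Finset.sum_congr rfl fun P _ => by ring

theorem partitionSum_cumulant {n : ℕ} (m : Finset (Fin n) → ℂ) (S : Finset (Fin n)) :
    partitionSum (fun _ => 1) (cumulant m) S = if S = ∅ then 1 else m S := by
  induction S using Finset.strongInduction with
  | H S ih =>
    split_ifs with hS
    · rw [hS, partitionSum_empty]
    · obtain ⟨a, ha⟩ := Finset.nonempty_iff_ne_empty.2 hS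
      rw [partitionSum_eq_sum_mem _ _ ha, ← sum_partitionSum_mul_sdiff m ha,
        ← cumulant_eq_partitionSum]
      refine Finset.sum_congr rfl fun B hB => ?_
      obtain ⟨hB, haB⟩ := Finset.mem_filter.1 hB
      rw [ih _ (Finset.sdiff_ssubset (Finset.mem_powerset.1 hB) ⟨a, haB⟩)]

/-- For every nonempty subset `S` of `{1,…,n}`, the moment `m(S)` equals the
sum over all set partitions `{B₁,…,B_k}` of `S` of the product `∏_j c(B_j)` of the cumulants
of the blocks. -/
theorem moment_eq_sum_prod_cumulants {n : ℕ} (hn : 1 ≤ n)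
    (m : Finset (Fin n) → ℂ) (S : Finset (Fin n)) (hS : S.Nonempty) :
    m S = ∑ P : Finpartition S, ∏ B ∈ P.parts, cumulant m B := by
  have h := partitionSum_cumulant m S
  rw [if_neg hS.ne_empty] at h
  simp [← h, partitionSum]
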